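/- arXiv:1812.08346 — 2 statements merged into one kernel-verified Lean document; each statement's English description precedes it below -/
import Mathlib

section
/- Let k be a finitely generated field of characteristic zero, A a finitely generated k-algebra that is an integral domain, and δ : A → A a k-linear derivation. Suppose there exists an infinite sequence (r_j : j < ω) in Frac(A) such that δ(r_j)/r_j ∈ A for all j, and such that the sequence is multiplicatively independent modulo (k^alg)^× (no nontrivial product of integer powers of the r_j lies in the algebraic closure of k inside Frac(A)^alg). Then there exists g ∈ Frac(A)^δ with g ∉ k^alg. In fact, if G is the multiplicative subgroup of Frac(A)^× generated by the r_j, then G ∩ Frac(A)^δ is nontrivial (contains an element ≠ 1). -/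
/-!
# Proposition 2.5 (refinement of Jouanolou–Hrushovski, after [bllsm, Prop. 6.10])

`k` is a finitely generated field of characteristic zero (finitely generated over its prime
field `ℚ`), `A` a finitely generated `k`-algebra which is an integral domain, and
`δ : A → A` a `k`-linear derivation.  The derivation extends uniquely to the fraction field
`Frac(A)`, modelled by an abstract fraction field `FA` together with the (necessarily
unique) compatible derivation `δ'`.

Given an infinite sequence `(r_j)` in `Frac(A)ˣ` with logarithmic derivatives in `A`
(`δ(r_j)/r_j ∈ A`) which is multiplicatively independent modulo `(k^alg)ˣ` — no nontrivial
product of integer powers of the `r_j` is algebraic over `k` — there is a constant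
`g ∈ Frac(A)^δ` not algebraic over `k`; in fact the group generated by the `r_j` contains a
constant `≠ 1`.
-/

theorem Derivation.logDeriv_zpow {F : Type*} [Field F] (D : Derivation ℤ F F) {x : F} (hx : x ≠ 0)
    (n : ℤ) : D (x ^ n) = x ^ n * (n * (D x / x)) := by
  induction n with
  | zero => simp
  | succ n ih =>
    rw [zpow_add_one₀ hx, D.leibniz, ih, smul_eq_mul, smul_eq_mul]
    push_cast
    field_simp
    ring
  | pred n ih =>
    rw [zpow_sub_one₀ hx, D.leibniz, ih, D.leibniz_inv, smul_eq_mul, smul_eq_mul, smul_eq_mul]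
    push_cast
    field_simp
    ring

/-- Suppose that the multiples `c • D` which are logarithmic for `w` act trivially on the residue
field, and that `D t = -t`. Then `c * (D x / x)` is, up to an element of the maximal ideal,
proportional to the order of `x`. -/
theorem Valuation.mul_logDeriv_sub_log_lt_one {F : Type*} [Field F]
    (w : Valuation F (WithZero (Multiplicative ℤ)))
    (D : Derivation ℤ F F) {c t : F} (ht0 : t ≠ 0) (htD : D t = -t)
    (hres : ∀ x, w x ≤ 1 → w (c * D x) < 1) {x : F} (hx : x ≠ 0) :
    w ((-WithZero.log (w t) : ℤ) * (c * (D x / x)) - c * (WithZero.log (w x) : ℤ)) < 1 := by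
  have hwt : w t ≠ 0 := (w.ne_zero_iff).2 ht0
  have hwx : w x ≠ 0 := (w.ne_zero_iff).2 hx
  set a := WithZero.log (w t) with ha
  set b := WithZero.log (w x) with hb
  have hu : w (x ^ (-a) * t ^ b) = 1 := by
    rw [map_mul, map_zpow₀, map_zpow₀, ← WithZero.exp_log hwt, ← WithZero.exp_log hwx,
      ← ha, ← hb, ← WithZero.exp_zsmul, ← WithZero.exp_zsmul, ← WithZero.exp_add,
      WithZero.exp_eq_one]
    simp only [smul_eq_mul]
    ring
  have hu0 : x ^ (-a) * t ^ b ≠ 0 := mul_ne_zero (zpow_ne_zero _ hx) (zpow_ne_zero _ ht0)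
  have key : c * D (x ^ (-a) * t ^ b) =
      (x ^ (-a) * t ^ b) * ((-a : ℤ) * (c * (D x / x)) - c * (b : ℤ)) := by
    rw [D.leibniz, D.logDeriv_zpow hx, D.logDeriv_zpow ht0, htD, smul_eq_mul, smul_eq_mul]
    field_simp
    ring
  have h := hres _ hu.le
  rwa [key, map_mul, hu, one_mul] at h

theorem Valuation.exists_logDeriv_sub_log_lt_one {F : Type*} [Field F]
    (w : Valuation F (WithZero (Multiplicative ℤ)))
    (D : Derivation ℤ F F) {t : F} (ht0 : t ≠ 0) (ht : w t < 1) (htD : D t = -t)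
    (hint : ∀ n : ℤ, n ≠ 0 → w n = 1)
    (hres : ∀ c, w c ≤ 1 → (∀ x, w (c * D x) ≤ w x) → ∀ x, w x ≤ 1 → w (c * D x) < 1)
    (hbdd : ∃ s, s ≠ 0 ∧ ∀ x, w (s * D x) ≤ w x) :
    ∃ e : ℤ, e ≠ 0 ∧ ∀ x, x ≠ 0 → w (e * (D x / x) - (WithZero.log (w x) : ℤ)) < 1 := by
  have hwt : w t ≠ 0 := (w.ne_zero_iff).2 ht0
  have he : -WithZero.log (w t) ≠ 0 := by
    have : WithZero.log (w t) < 0 := by rwa [WithZero.log_lt_iff_lt_exp hwt, WithZero.exp_zero]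
    omega
  suffices hlog : ∀ x, w (D x) ≤ w x by
    refine ⟨_, he, fun x hx ↦ ?_⟩
    have := w.mul_logDeriv_sub_log_lt_one D (c := 1) ht0 htD
      (hres 1 (by simp) (by simpa using hlog)) hx
    simpa using this
  obtain ⟨s, hs0, hs⟩ := hbdd
  have hws : w s ≠ 0 := (w.ne_zero_iff).2 hs0
  obtain ⟨m, ⟨x₀, hDx₀, rfl⟩, hm⟩ := Int.exists_greatest_of_bdd
    (P := fun m ↦ ∃ x, D x ≠ 0 ∧ WithZero.log (w (D x / x)) = m)
    ⟨-WithZero.log (w s), by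
      rintro _ ⟨x, hDx, rfl⟩
      have hx : x ≠ 0 := by rintro rfl; simp at hDx
      have hwx : w x ≠ 0 := (w.ne_zero_iff).2 hx
      have hwD : w (D x) ≠ 0 := (w.ne_zero_iff).2 hDx
      have h := hs x
      rw [map_mul, ← WithZero.log_le_log (mul_ne_zero hws hwD) hwx, WithZero.log_mul hws hwD] at h
      rw [map_div₀, WithZero.log_div hwD hwx]
      linarith⟩
    ⟨_, t, by simpa [htD] using ht0, rfl⟩
  have hx₀ : x₀ ≠ 0 := by rintro rfl; simp at hDx₀
  have hd0 : w (D x₀ / x₀) ≠ 0 := (w.ne_zero_iff).2 (div_ne_zero hDx₀ hx₀)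
  have hmax : ∀ x, w (D x) ≤ w (D x₀ / x₀) * w x := by
    intro x
    by_cases hDx : D x = 0
    · simp [hDx]
    have hx : x ≠ 0 := by rintro rfl; simp at hDx
    have hwx : w x ≠ 0 := (w.ne_zero_iff).2 hx
    have := hm _ ⟨x, hDx, rfl⟩
    rw [WithZero.log_le_log ((w.ne_zero_iff).2 (div_ne_zero hDx hx)) hd0] at this
    calc w (D x) = w (D x / x) * w x := by rw [← map_mul, div_mul_cancel₀ _ hx]
      _ ≤ _ := by gcongr
  rcases le_or_gt (w (D x₀ / x₀)) 1 with hle | hgt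
  · exact fun x ↦ (hmax x).trans (mul_le_of_le_one_left' hle)
  exfalso
  have hc : w (x₀ / D x₀) < 1 := by
    rw [← inv_div, map_inv₀]
    exact inv_lt_one_of_one_lt₀ hgt
  have hlogc : ∀ x, w (x₀ / D x₀ * D x) ≤ w x := by
    intro x
    rw [map_mul, ← inv_div, map_inv₀, inv_mul_le_iff₀ (zero_lt_iff.2 hd0)]
    exact hmax x
  have h := w.mul_logDeriv_sub_log_lt_one D ht0 htD (hres _ hc.le hlogc) hx₀
  rw [div_mul_div_cancel₀ hDx₀, div_self hx₀, mul_one] at h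
  have hint' : ∀ n : ℤ, w n ≤ 1 := fun n ↦ by
    rcases eq_or_ne n 0 with rfl | hn
    · simp
    · exact (hint n hn).le
  have h2 : w (x₀ / D x₀ * (WithZero.log (w x₀) : ℤ)) < 1 := by
    rw [map_mul]
    exact mul_lt_one_of_lt_of_le hc (hint' _)
  have := w.map_add_lt h h2
  rw [sub_add_cancel, hint _ he] at this
  exact lt_irrefl _ this

open Polynomial in
theorem Derivation.map_mul_lt_one_of_isIntegral (K : Type*) [Field K] [CharZero K] {O F : Type*}
    [CommRing O] [Nontrivial O] [Field F] [Algebra K O] [Algebra O F] {Γ : Type*}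
    [LinearOrderedCommGroupWithZero Γ] (w : Valuation F Γ) (hw : ∀ x, IsIntegral O x → w x ≤ 1)
    (D : Derivation ℤ F F) (c : F) (hDO : ∀ o, w (c * D (algebraMap O F o)) < 1)
    (hDw : ∀ x, w (c * D x) ≤ w x) {x : F} (hx : IsIntegral O x) : w (c * D x) < 1 := by
  have hwf : ∀ f : O[X], w (aeval x f) ≤ 1 := fun f ↦ hw _ (by
    rw [aeval_eq_sum_range]
    exact IsIntegral.sum _ fun i _ ↦ (hx.pow i).smul _)
  have hderiv : ∀ f : O[X], w (c * D (aeval x f) - aeval x (derivative f) * (c * D x)) < 1 := by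
    intro f
    induction f using Polynomial.induction_on' with
    | add p q hp hq =>
      convert w.map_add_lt hp hq using 2
      simp only [map_add]
      ring
    | monomial n a =>
      have : c * D (aeval x (monomial n a)) - aeval x (derivative (monomial n a)) * (c * D x) =
          x ^ n * (c * D (algebraMap O F a)) := by
        rw [derivative_monomial, aeval_monomial, aeval_monomial, D.leibniz, D.leibniz_pow]
        simp only [smul_eq_mul, nsmul_eq_mul, map_mul, _root_.map_natCast]
        ring
      rw [this, map_mul]
      exact mul_lt_one_of_nonneg_of_lt_one_right (hw _ (hx.pow n)) zero_le (hDO a)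
  suffices H : ∀ n, ∀ f : O[X], f.Monic → f.natDegree = n → w (aeval x f) < 1 →
      w (c * D x) < 1 by
    obtain ⟨f, hf, hfx⟩ := hx
    exact H _ f hf rfl (by rw [aeval_def, hfx]; simp)
  intro n
  induction n with
  | zero =>
    intro f hf hn hlt
    simp [(hf.natDegree_eq_zero).1 hn] at hlt
  | succ n ih =>
    intro f hf hn hlt
    rcases (hwf (derivative f)).lt_or_eq with hlt' | heq
    · have hinv : algebraMap K O ((n : K) + 1)⁻¹ * ((n : O) + 1) = 1 := by
        have : ((n : O) + 1) = algebraMap K O ((n : K) + 1) := by simp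
        rw [this, ← map_mul, inv_mul_cancel₀ (by exact_mod_cast n.succ_ne_zero), map_one]
      have hdeg : (derivative f).natDegree ≤ n := by
        have := natDegree_derivative_le f
        omega
      have hcoeff : (C (algebraMap K O ((n : K) + 1)⁻¹) * derivative f).coeff n = 1 := by
        rw [coeff_C_mul, coeff_derivative, ← hn, hf.coeff_natDegree, one_mul, hinv]
      have hle : (C (algebraMap K O ((n : K) + 1)⁻¹) * derivative f).natDegree ≤ n :=
        (natDegree_C_mul_le _ _).trans hdeg
      refine ih _ (monic_of_natDegree_le_of_coeff_eq_one n hle hcoeff)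
        (hle.antisymm (le_natDegree_of_ne_zero (by simp [hcoeff]))) ?_
      rw [map_mul, map_mul]
      exact mul_lt_one_of_nonneg_of_lt_one_right (hwf _) zero_le hlt'
    · have h := w.map_sub_lt ((hDw _).trans_lt hlt) (hderiv f)
      rwa [sub_sub_cancel, map_mul, heq, one_mul] at h

theorem IsDiscreteValuationRing.isPrincipalIdealRing_integralClosure (O E : Type*) {F : Type*} [CommRing O]
    [IsDomain O] [IsDiscreteValuationRing O] [Field E] [Algebra O E] [IsFractionRing O E] [Field F]
    [Algebra E F] [FiniteDimensional E F] [Algebra.IsSeparable E F] [Algebra O F]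
    [IsScalarTower O E F] :
    IsPrincipalIdealRing (integralClosure O F) := by
  have := integralClosure.isDedekindDomain O E F
  have : Module.IsTorsionFree O F := by
    rw [Module.isTorsionFree_iff_faithfulSMul, faithfulSMul_iff_algebraMap_injective,
      IsScalarTower.algebraMap_eq O E F]
    exact (algebraMap E F).injective.comp (IsFractionRing.injective O E)
  apply IsPrincipalIdealRing.of_finite_maximals
  refine (IsDedekindDomain.primesOver_finite (IsLocalRing.maximalIdeal O)
    (integralClosure O F)).subset fun I hI ↦ ?_
  have hI : I.IsMaximal := hI
  exact ⟨hI.isPrime, ⟨(IsLocalRing.eq_maximalIdeal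
    (Ideal.isMaximal_comap_of_isIntegral_of_isMaximal I)).symm⟩⟩

theorem IsDiscreteValuationRing.dvd_algebraMap_of_irreducible (O E : Type*) {F : Type*} [CommRing O]
    [IsDomain O] [IsDiscreteValuationRing O] [Field E] [Algebra O E] [IsFractionRing O E] [Field F]
    [Algebra E F] [FiniteDimensional E F] [Algebra.IsSeparable E F] [Algebra O F]
    [IsScalarTower O E F]
    {t : O}
    (ht : t ∈ IsLocalRing.maximalIdeal O) {p : integralClosure O F} (hp : Irreducible p) :
    p ∣ algebraMap O _ t := by
  have := IsDiscreteValuationRing.isPrincipalIdealRing_integralClosure O E (F := F)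
  have hprime := hp.prime
  rw [← Ideal.mem_span_singleton, ← Ideal.mem_comap]
  have hmax := (PrincipalIdealRing.isMaximal_of_irreducible hp)
  rwa [IsLocalRing.eq_maximalIdeal (Ideal.isMaximal_comap_of_isIntegral_of_isMaximal
    (R := O) (Ideal.span {p}))]

theorem Derivation.exists_smul_isIntegral (O E : Type*) {F : Type*} [CommRing O]
    [IsDomain O] [IsDiscreteValuationRing O] [Field E] [Algebra O E] [IsFractionRing O E] [Field F]
    [Algebra E F] [FiniteDimensional E F] [Algebra.IsSeparable E F] [Algebra O F]
    [IsScalarTower O E F]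
    (D : Derivation ℤ F F)
    (hD : ∃ t : O, t ≠ 0 ∧ ∀ o, IsIntegral O (t • D (algebraMap O F o))) :
    ∃ s : O, s ≠ 0 ∧ ∀ x, IsIntegral O x → IsIntegral O (s • D x) := by
  classical
  obtain ⟨t, ht0, ht⟩ := hD
  have := IsIntegralClosure.finite O E F (integralClosure O F)
  obtain ⟨G, hG⟩ := Module.Finite.fg_top (R := O) (M := integralClosure O F)
  obtain ⟨u, hu0, hu⟩ := exists_integral_multiples O E
    (G.image fun g : integralClosure O F ↦ D (g : F))
  refine ⟨t * u, mul_ne_zero ht0 hu0, fun x hx ↦ ?_⟩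
  have hmem : (⟨x, hx⟩ : integralClosure O F) ∈ Submodule.span O (G : Set (integralClosure O F)) :=
    hG ▸ Submodule.mem_top
  suffices ∀ y ∈ Submodule.span O (G : Set (integralClosure O F)),
    IsIntegral O ((t * u) • D (y : F)) from this _ hmem
  intro y hy
  induction hy using Submodule.span_induction with
  | mem y hy =>
    rw [mul_smul]
    exact (hu _ (Finset.mem_image_of_mem _ hy)).smul t
  | zero => simpa using isIntegral_zero
  | add y z _ _ hy hz => simpa using hy.add hz
  | smul a y _ hy =>
    have : (t * u) • D ((a • y : integralClosure O F) : F) =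
        a • ((t * u) • D (y : F)) + u • ((y : F) * (t • D (algebraMap O F a))) := by
      have : ((a • y : integralClosure O F) : F) = algebraMap O F a * y := by
        simp [Algebra.smul_def]
      rw [this, D.leibniz]
      simp only [Algebra.smul_def, map_mul, Algebra.algebraMap_self, RingHom.id_apply]
      ring
    rw [this]
    exact (hy.smul a).add ((y.2.mul (ht a)).smul u)

/-- Logarithmic derivatives have bounded denominators over a discrete valuation ring. -/
theorem Derivation.exists_smul_logDeriv_isIntegral (O E : Type*) {F : Type*} [CommRing O]
    [IsDomain O] [IsDiscreteValuationRing O] [Field E] [Algebra O E] [IsFractionRing O E] [Field F]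
    [Algebra E F] [FiniteDimensional E F] [Algebra.IsSeparable E F] [Algebra O F]
    [IsScalarTower O E F]
    (D : Derivation ℤ F F)
    (hD : ∃ t : O, t ≠ 0 ∧ ∀ o, IsIntegral O (t • D (algebraMap O F o))) :
    ∃ s : O, s ≠ 0 ∧ ∀ x, x ≠ 0 → IsIntegral O (s • (D x / x)) := by
  obtain ⟨s, hs0, hs⟩ := D.exists_smul_isIntegral O E hD
  obtain ⟨t, ht⟩ := IsDiscreteValuationRing.exists_irreducible O
  have := IsDiscreteValuationRing.isPrincipalIdealRing_integralClosure O E (F := F)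
  have := integralClosure.isFractionRing_of_finite_extension (A := O) E F
  have key : ∀ a : integralClosure O F, a ≠ 0 → IsIntegral O ((t * s) • (D (a : F) / a)) := by
    intro a
    induction a using WfDvdMonoid.induction_on_irreducible with
    | zero => simp
    | unit u hu =>
      intro _
      obtain ⟨u, rfl⟩ := hu
      have h0 : ((u : integralClosure O F) : F) ≠ 0 := by simp
      have : (t * s) • (D ((u : integralClosure O F) : F) / (u : integralClosure O F)) =
          t • ((s • D ((u : integralClosure O F) : F)) *
            ((u⁻¹ : (integralClosure O F)ˣ) : integralClosure O F)) := by
        have : ((u : integralClosure O F) : F) *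
            ((u⁻¹ : (integralClosure O F)ˣ) : integralClosure O F) = 1 := by
          rw [← MulMemClass.coe_mul]; simp
        rw [mul_smul, div_eq_mul_inv, eq_inv_of_mul_eq_one_right this, smul_mul_assoc]
      rw [this]
      exact ((hs _ (u : integralClosure O F).2).mul (Subtype.prop _)).smul t
    | mul a p ha hp ih =>
      intro _
      obtain ⟨q, hq⟩ := IsDiscreteValuationRing.dvd_algebraMap_of_irreducible O E (F := F)
        ((IsLocalRing.mem_maximalIdeal t).2 ht.not_isUnit) hp
      have hq' : algebraMap O F t = p * q := by
        rw [← MulMemClass.coe_mul, ← hq]; rfl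
      have hp0 : (p : F) ≠ 0 := by simpa using hp.ne_zero
      have ha0 : (a : F) ≠ 0 := by simpa using ha
      have : (t * s) • (D ((p * a : integralClosure O F) : F) / (p * a : integralClosure O F)) =
          (t * s) • (D (a : F) / a) + q * (s • D (p : F)) := by
        rw [MulMemClass.coe_mul, D.leibniz]
        simp only [Algebra.smul_def, map_mul, hq', Algebra.algebraMap_self, RingHom.id_apply]
        field_simp
      rw [this]
      exact (ih ha).add (q.2.mul (hs _ p.2))
  refine ⟨t * s, mul_ne_zero ht.ne_zero hs0, fun x hx ↦ ?_⟩
  obtain ⟨a, b, hb, rfl⟩ := IsFractionRing.div_surjective (A := integralClosure O F) x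
  have ha0 : algebraMap (integralClosure O F) F a ≠ 0 := by rintro h; simp [h] at hx
  have hb0 : algebraMap (integralClosure O F) F b ≠ 0 := by rintro h; simp [h] at hx
  have := (key a (by rintro rfl; simp at ha0)).sub (key b (by rintro rfl; simp at hb0))
  have hab : D (algebraMap (integralClosure O F) F a / algebraMap _ F b) /
        (algebraMap (integralClosure O F) F a / algebraMap _ F b) =
      D (a : F) / (a : F) - D (b : F) / (b : F) := by
    change _ = D (algebraMap (integralClosure O F) F a) / algebraMap (integralClosure O F) F a -
      D (algebraMap (integralClosure O F) F b) / algebraMap (integralClosure O F) F b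
    rw [D.leibniz_div]
    simp only [smul_eq_mul]
    field_simp
  rwa [hab, smul_sub]

/-- The tame residue formula: a derivation which is residually trivial on a discrete valuation ring
and satisfies `D t = -t` computes, up to a scalar, the order of elements of a finite extension. -/
theorem Derivation.exists_valuation_logDeriv (O E : Type*) {F : Type*} [CommRing O]
    [IsDomain O] [IsDiscreteValuationRing O] [Field E] [Algebra O E] [IsFractionRing O E] [Field F]
    [Algebra E F] [FiniteDimensional E F] [Algebra.IsSeparable E F] [Algebra O F]
    [IsScalarTower O E F]
    (K : Type*) [Field K] [CharZero K] [Algebra K O]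
    [Algebra K F] [IsScalarTower K O F] (D : Derivation ℤ F F)
    (hD : ∀ o, ∃ o' ∈ IsLocalRing.maximalIdeal O, D (algebraMap O F o) = algebraMap O F o')
    {t : O} (ht : t ∈ IsLocalRing.maximalIdeal O) (ht0 : t ≠ 0)
    (hDt : D (algebraMap O F t) = -algebraMap O F t) :
    ∃ w : Valuation F (WithZero (Multiplicative ℤ)), (∀ c : K, c ≠ 0 → w (algebraMap K F c) = 1) ∧
      w (algebraMap O F t) < 1 ∧ ∃ e : ℤ, e ≠ 0 ∧
        ∀ x, x ≠ 0 → w (e * (D x / x) - (WithZero.log (w x) : ℤ)) < 1 := by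
  have := integralClosure.isDedekindDomain O E F
  have := integralClosure.isFractionRing_of_finite_extension (A := O) E F
  have hinj : Function.Injective (algebraMap O F) := by
    rw [IsScalarTower.algebraMap_eq O E F]
    exact (algebraMap E F).injective.comp (IsFractionRing.injective O E)
  obtain ⟨P, hP⟩ := Ideal.exists_maximal (integralClosure O F)
  have hcomap : P.comap (algebraMap O (integralClosure O F)) = IsLocalRing.maximalIdeal O :=
    IsLocalRing.eq_maximalIdeal (Ideal.isMaximal_comap_of_isIntegral_of_isMaximal P)
  have hmem : ∀ o ∈ IsLocalRing.maximalIdeal O, algebraMap O (integralClosure O F) o ∈ P :=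
    fun o ho ↦ by rwa [← Ideal.mem_comap, hcomap]
  have hPbot : P ≠ ⊥ := by
    rintro rfl
    have := hmem t ht
    rw [Ideal.mem_bot] at this
    exact ht0 (hinj (by simpa using congrArg (algebraMap (integralClosure O F) F) this))
  let v : IsDedekindDomain.HeightOneSpectrum (integralClosure O F) := ⟨P, hP.isPrime, hPbot⟩
  let w := v.valuation F
  have hw1 : ∀ x, IsIntegral O x → w x ≤ 1 := fun x hx ↦ v.valuation_le_one ⟨x, hx⟩
  have hwm : ∀ o ∈ IsLocalRing.maximalIdeal O, w (algebraMap O F o) < 1 := fun o ho ↦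
    (v.valuation_lt_one_iff_mem (K := F) (algebraMap O (integralClosure O F) o)).2 (hmem o ho)
  have hwK : ∀ c : K, c ≠ 0 → w (algebraMap K F c) = 1 := by
    have hle : ∀ c : K, w (algebraMap K F c) ≤ 1 := fun c ↦ by
      rw [IsScalarTower.algebraMap_apply K O F]
      exact hw1 _ isIntegral_algebraMap
    refine fun c hc ↦ (hle c).antisymm ?_
    have := hle c⁻¹
    rwa [map_inv₀, map_inv₀, inv_le_one₀ (zero_lt_iff.2 (by simpa using hc))] at this
  refine ⟨w, hwK, hwm t ht, w.exists_logDeriv_sub_log_lt_one D ?_ (hwm t ht) hDt ?_ ?_ ?_⟩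
  · simpa using hinj.ne ht0
  · intro n hn
    simpa using hwK n (by simpa using hn)
  · intro c hc hcw x hx
    have hres : ∀ y, IsIntegral O y → w (c * D y) < 1 := fun y hy ↦
      D.map_mul_lt_one_of_isIntegral K w hw1 c (fun o ↦ by
        obtain ⟨o', ho', h⟩ := hD o
        rw [h, map_mul]
        exact mul_lt_one_of_nonneg_of_lt_one_right hc zero_le (hwm o' ho')) hcw hy
    obtain ⟨n, d, hnd⟩ := v.exists_primeCompl_mul_eq_of_integer x hx
    have hd : w (algebraMap _ F (d : integralClosure O F)) = 1 :=
      v.valuation_eq_one_iff_notMem.2 d.2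
    have h1 := hres _ n.2
    have h2 : w (x * (c * D (algebraMap _ F (d : integralClosure O F)))) < 1 := by
      rw [map_mul]
      exact mul_lt_one_of_nonneg_of_lt_one_right hx zero_le (hres _ (d : integralClosure O F).2)
    have h3 := w.map_sub_lt h1 h2
    have : c * D (n : F) - x * (c * D (algebraMap _ F (d : integralClosure O F))) =
        algebraMap _ F (d : integralClosure O F) * (c * D x) := by
      change c * D (algebraMap _ F n) - _ = _
      rw [← hnd, D.leibniz, smul_eq_mul, smul_eq_mul]
      ring
    rwa [this, map_mul, hd, one_mul] at h3
  · obtain ⟨s, hs0, hs⟩ := D.exists_smul_logDeriv_isIntegral O E ⟨1, one_ne_zero, fun o ↦ by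
      obtain ⟨o', -, h⟩ := hD o
      rw [h, one_smul]
      exact isIntegral_algebraMap⟩
    refine ⟨algebraMap O F s, by simpa using hinj.ne hs0, fun x ↦ ?_⟩
    rcases eq_or_ne x 0 with rfl | hx
    · simp
    have := hw1 _ (hs x hx)
    rw [Algebra.smul_def, ← mul_div_assoc, map_div₀,
      div_le_one₀ (zero_lt_iff.2 ((w.ne_zero_iff).2 hx))] at this
    exact this

namespace MvPolynomial

open WithZero

variable {ι K : Type*} [Field K]

variable (ι K) in
/-- The valuation on a polynomial ring given by the total degree. -/
noncomputable def degreeValuation : Valuation (MvPolynomial ι K) (WithZero (Multiplicative ℤ)) where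
  toFun f := by classical exact if f = 0 then 0 else exp (f.totalDegree : ℤ)
  map_zero' := by simp
  map_one' := by simp
  map_mul' f g := by
    classical
    by_cases hf : f = 0
    · simp [hf]
    by_cases hg : g = 0
    · simp [hg]
    simp [hf, hg, totalDegree_mul_of_isDomain hf hg, exp_add]
  map_add_le_max' f g := by
    classical
    by_cases hf : f = 0
    · simp [hf]
    by_cases hg : g = 0
    · simp [hg]
    by_cases hfg : f + g = 0
    · simp [hfg]
    simpa [hf, hg, hfg] using totalDegree_add f g

theorem degreeValuation_apply {f : MvPolynomial ι K} (hf : f ≠ 0) :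
    degreeValuation ι K f = exp (f.totalDegree : ℤ) := by
  classical
  exact if_neg hf

theorem degreeValuation_lt_exp {f : MvPolynomial ι K} {n : ℕ}
    (h : ∀ s ∈ f.support, s.degree < n) : degreeValuation ι K f < exp (n : ℤ) := by
  by_cases hf : f = 0
  · simp [hf]
  rw [degreeValuation_apply hf, exp_lt_exp, Nat.cast_lt]
  obtain ⟨s, hs⟩ := support_nonempty.2 hf
  rw [totalDegree, Finset.sup_lt_iff (bot_le.trans_lt (h s hs))]
  exact h

theorem degreeValuation_le_exp {f : MvPolynomial ι K} {n : ℕ}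
    (h : ∀ s ∈ f.support, s.degree ≤ n) : degreeValuation ι K f ≤ exp (n : ℤ) := by
  by_cases hf : f = 0
  · simp [hf]
  rw [degreeValuation_apply hf, exp_le_exp, Nat.cast_le]
  exact Finset.sup_le h

theorem degreeValuation_pos {f : MvPolynomial ι K} (hf : f ≠ 0) : 0 < degreeValuation ι K f := by
  rw [degreeValuation_apply hf]
  exact exp_pos

theorem degreeValuation_C {c : K} (hc : c ≠ 0) : degreeValuation ι K (C c) = 1 := by
  rw [degreeValuation_apply (by simpa using hc)]
  simp

theorem degreeValuation_X (i : ι) : degreeValuation ι K (X i) = exp (1 : ℤ) := by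
  rw [degreeValuation_apply (X_ne_zero i), totalDegree_X, Nat.cast_one]

theorem degreeValuation_pderiv_le (i : ι) (f : MvPolynomial ι K) :
    degreeValuation ι K (pderiv i f) ≤ degreeValuation ι K f := by
  by_cases hf : f = 0
  · simp [hf]
  rw [degreeValuation_apply hf]
  refine (degreeValuation_lt_exp fun s hs ↦ ?_).le
  rw [mem_support_iff, coeff_pderiv] at hs
  have := le_totalDegree (mem_support_iff.2 (left_ne_zero_of_mul hs))
  change (s + Finsupp.single i 1).degree ≤ _ at this
  rw [map_add, Finsupp.degree_single] at this
  omega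

theorem degreeValuation_pderiv_mul_sub_le {f g : MvPolynomial ι K}
    (h : degreeValuation ι K f ≤ degreeValuation ι K g) (i : ι) :
    degreeValuation ι K (pderiv i f * g - f * pderiv i g) ≤ degreeValuation ι K (g * g) := by
  refine Valuation.map_sub_le (v := degreeValuation ι K) ?_ ?_ <;> rw [map_mul, map_mul] <;>
  gcongr
  · exact (degreeValuation_pderiv_le i f).trans h
  · exact degreeValuation_pderiv_le i g

variable [Fintype ι]

variable (ι K) in
/-- The Euler derivation. -/
noncomputable def eulerDerivation : Derivation K (MvPolynomial ι K) (MvPolynomial ι K) :=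
  ∑ i, (X i : MvPolynomial ι K) • pderiv i

theorem eulerDerivation_apply (f : MvPolynomial ι K) :
    eulerDerivation ι K f = ∑ i, X i * pderiv i f := by
  exact (congrFun (map_sum Derivation.coeFnAddMonoidHom
    (fun i ↦ (X i : MvPolynomial ι K) • pderiv i) Finset.univ) f).trans (by simp [Finset.sum_apply])

theorem eulerDerivation_X (i : ι) : eulerDerivation ι K (X i) = X i := by
  rw [eulerDerivation_apply, (isHomogeneous_X K i).sum_X_mul_pderiv, one_smul]

theorem coeff_eulerDerivation (f : MvPolynomial ι K) (s : ι →₀ ℕ) :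
    (eulerDerivation ι K f).coeff s = s.degree * f.coeff s := by
  classical
  induction f using MvPolynomial.induction_on' with
  | monomial u a =>
    rw [eulerDerivation_apply, (isHomogeneous_monomial a rfl).sum_X_mul_pderiv, coeff_smul,
      coeff_monomial]
    split_ifs with h <;> simp [h]
  | add p q hp hq => rw [map_add, coeff_add, coeff_add, hp, hq, mul_add]

theorem degreeValuation_eulerDerivation_sub_lt {f : MvPolynomial ι K} (hf : f ≠ 0) :
    degreeValuation ι K (eulerDerivation ι K f - f.totalDegree • f) < degreeValuation ι K f := by
  rw [degreeValuation_apply hf]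
  refine degreeValuation_lt_exp fun s hs ↦ ?_
  rw [mem_support_iff, coeff_sub, coeff_eulerDerivation, coeff_smul, nsmul_eq_mul,
    ← sub_mul] at hs
  refine (le_totalDegree (mem_support_iff.2 (right_ne_zero_of_mul hs))).lt_of_ne fun h ↦ ?_
  refine left_ne_zero_of_mul hs ?_
  change s.degree = _ at h
  rw [h, sub_self]

theorem degreeValuation_eulerDerivation_le (f : MvPolynomial ι K) :
    degreeValuation ι K (eulerDerivation ι K f) ≤ degreeValuation ι K f := by
  by_cases hf : f = 0
  · simp [hf]
  rw [degreeValuation_apply hf]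
  refine degreeValuation_le_exp fun s hs ↦ ?_
  rw [mem_support_iff, coeff_eulerDerivation] at hs
  exact le_totalDegree (mem_support_iff.2 (right_ne_zero_of_mul hs))

theorem degreeValuation_eulerDerivation_mul_sub_lt {f g : MvPolynomial ι K} (hg : g ≠ 0)
    (h : degreeValuation ι K f ≤ degreeValuation ι K g) :
    degreeValuation ι K (eulerDerivation ι K f * g - f * eulerDerivation ι K g) <
      degreeValuation ι K (g * g) := by
  have hg0 : 0 < degreeValuation ι K g := degreeValuation_pos hg
  rcases h.lt_or_eq with hlt | heq
  · refine Valuation.map_sub_lt _ ?_ ?_ <;> rw [map_mul, map_mul]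
    · gcongr
      exact (degreeValuation_eulerDerivation_le f).trans_lt hlt
    · exact mul_lt_mul_of_lt_of_le_of_nonneg_of_pos hlt (degreeValuation_eulerDerivation_le g)
        zero_le hg0
  · have hf : f ≠ 0 := by
      rintro rfl
      simp [← heq] at hg0
    have hdeg : f.totalDegree = g.totalDegree := by
      rw [degreeValuation_apply hf, degreeValuation_apply hg, exp_inj] at heq
      exact_mod_cast heq
    have : eulerDerivation ι K f * g - f * eulerDerivation ι K g =
        (eulerDerivation ι K f - f.totalDegree • f) * g -
          f * (eulerDerivation ι K g - g.totalDegree • g) := by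
      rw [hdeg]
      simp only [nsmul_eq_mul]
      ring
    rw [this]
    refine Valuation.map_sub_lt _ ?_ ?_ <;> rw [map_mul, map_mul]
    · rw [← heq]
      exact mul_lt_mul_of_pos_right (degreeValuation_eulerDerivation_sub_lt hf) (heq ▸ hg0)
    · rw [heq]
      gcongr
      exact degreeValuation_eulerDerivation_sub_lt hg

end MvPolynomial

section ExtendDerivation

variable {R S T : Type*} [CommRing R] [CommRing S] [CommRing T] [Algebra R S] [Algebra R T]
  [Algebra S T] [IsScalarTower R S T]

theorem Derivation.exists_map_algebraMap_eq [Algebra.FormallyEtale S T] (d : Derivation R S S) :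
    ∃ D : Derivation R T T, ∀ s, D (algebraMap S T s) = algebraMap S T (d s) := by
  let l : TensorProduct S T (Ω[S⁄R]) →ₗ[T] T :=
    (TensorProduct.AlgebraTensorModule.lift ((LinearMap.toSpanSingleton T _
      ((Algebra.linearMap S T) ∘ₗ d.liftKaehlerDifferential))))
  refine ⟨(l ∘ₗ
    (KaehlerDifferential.tensorKaehlerEquivOfFormallyEtale R S T).symm.toLinearMap).compDer
    (KaehlerDifferential.D R T), fun s ↦ ?_⟩
  change l ((KaehlerDifferential.tensorKaehlerEquivOfFormallyEtale R S T).symm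
    (KaehlerDifferential.D R T _)) = _
  simp [l, KaehlerDifferential.tensorKaehlerEquivOfFormallyEtale_symm_D_algebraMap]

end ExtendDerivation

section RationalFunctions

open MvPolynomial WithZero

variable (ι K E : Type*) [Field K] [Field E] [Algebra (MvPolynomial ι K) E]
  [IsFractionRing (MvPolynomial ι K) E]

/-- The extension of the degree valuation to the field of rational functions. -/
noncomputable def MvPolynomial.ratDegreeValuation :
    Valuation E (WithZero (Multiplicative ℤ)) :=
  (degreeValuation ι K).extendToLocalization (S := nonZeroDivisors (MvPolynomial ι K))
    (fun _ hf ↦ (degreeValuation_pos (nonZeroDivisors.ne_zero hf)).ne') E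

variable {ι K}

@[simp]
theorem MvPolynomial.ratDegreeValuation_algebraMap (f : MvPolynomial ι K) :
    ratDegreeValuation ι K E (algebraMap _ E f) = degreeValuation ι K f :=
  Valuation.extendToLocalization_apply_map_apply ..

instance MvPolynomial.isNontrivial_ratDegreeValuation [Nonempty ι] :
    (ratDegreeValuation ι K E).IsNontrivial := by
  obtain ⟨i⟩ := ‹Nonempty ι›
  refine ⟨algebraMap _ E (X i : MvPolynomial ι K), ?_, ?_⟩ <;>
  simp [degreeValuation_X]

variable {F : Type*} [Field F] [Algebra (MvPolynomial ι K) F] [Algebra E F]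
  [IsScalarTower (MvPolynomial ι K) E F]

theorem MvPolynomial.exists_eq_div_of_ratDegree (o : (ratDegreeValuation ι K E).valuationSubring) :
    ∃ f g : MvPolynomial ι K, g ≠ 0 ∧ degreeValuation ι K f ≤ degreeValuation ι K g ∧
      algebraMap _ F o = algebraMap _ F f / algebraMap _ F g := by
  obtain ⟨f, g, hg, hfg⟩ := IsFractionRing.div_surjective (A := MvPolynomial ι K) (o : E)
  have hg0 : g ≠ 0 := nonZeroDivisors.ne_zero hg
  refine ⟨f, g, hg0, ?_, ?_⟩
  · have := o.2
    rwa [← hfg, Valuation.mem_valuationSubring_iff, map_div₀, ratDegreeValuation_algebraMap,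
      ratDegreeValuation_algebraMap, div_le_one₀ (degreeValuation_pos hg0)] at this
  · rw [IsScalarTower.algebraMap_apply (MvPolynomial ι K) E F,
      IsScalarTower.algebraMap_apply (MvPolynomial ι K) E F, ← map_div₀, hfg]
    rfl

theorem MvPolynomial.exists_ratDegree_eq_div {f g : MvPolynomial ι K} (hg : g ≠ 0)
    (h : degreeValuation ι K f ≤ degreeValuation ι K g) :
    ∃ o : (ratDegreeValuation ι K E).valuationSubring,
      ratDegreeValuation ι K E o = degreeValuation ι K f / degreeValuation ι K g ∧
      algebraMap _ F o = algebraMap _ F f / algebraMap _ F g := by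
  have hv : ratDegreeValuation ι K E (algebraMap _ E f / algebraMap _ E g) =
      degreeValuation ι K f / degreeValuation ι K g := by
    rw [map_div₀, ratDegreeValuation_algebraMap, ratDegreeValuation_algebraMap]
  refine ⟨⟨algebraMap _ E f / algebraMap _ E g, ?_⟩, hv, ?_⟩
  · rwa [Valuation.mem_valuationSubring_iff, hv, div_le_one₀ (degreeValuation_pos hg)]
  · change algebraMap E F (algebraMap _ E f / algebraMap _ E g) = _
    rw [map_div₀, ← IsScalarTower.algebraMap_apply, ← IsScalarTower.algebraMap_apply]

variable [Algebra K F]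

/-- Elements of a function field which are integral away from infinity and have bounded poles at
infinity form a finite-dimensional space. -/
theorem MvPolynomial.exists_finite_of_isIntegral [Finite ι] [FiniteDimensional E F]
    [Algebra.IsSeparable E F] [Algebra K E] [IsScalarTower K (MvPolynomial ι K) E]
    [IsScalarTower K E F]
    (s : (ratDegreeValuation ι K E).valuationSubring) (hs : s ≠ 0) :
    ∃ W : Submodule K F, Module.Finite K W ∧ ∀ a, IsIntegral (MvPolynomial ι K) a →
      IsIntegral (ratDegreeValuation ι K E).valuationSubring (s • a) → a ∈ W := by
  classical
  let b := Module.finBasis E F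
  obtain ⟨d, hd0, hd⟩ := exists_integral_multiples (MvPolynomial ι K) E (Finset.univ.image b)
  obtain ⟨u, hu0, hu⟩ := exists_integral_multiples (ratDegreeValuation ι K E).valuationSubring E
    (Finset.univ.image fun j ↦ d • b j)
  have hsu :
      ratDegreeValuation ι K E (s * u : (ratDegreeValuation ι K E).valuationSubring) ≠ 0 := by
    simp [hs, hu0]
  let T : F →ₗ[K] (Fin (Module.finrank E F) → E) := LinearMap.pi fun j ↦
    ((Algebra.trace E F).restrictScalars K) ∘ₗ (LinearMap.mulRight K (d • b j))
  have hT (a j) : T a j = Algebra.trace E F (a * (d • b j)) := rfl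
  have hTinj : Function.Injective T := by
    rw [← LinearMap.ker_eq_bot, LinearMap.ker_eq_bot']
    intro a ha
    have hd : algebraMap _ E d ≠ 0 := by simpa using hd0
    have : Algebra.traceForm E F a = 0 := b.ext fun j ↦ by
      have := congrFun ha j
      rw [hT, ← algebraMap_smul E d (b j), mul_smul_comm, map_smul] at this
      simpa [hd] using this
    exact (traceForm_nondegenerate E F).1 a fun y ↦ by rw [this]; rfl
  let m : ℕ := (-log (ratDegreeValuation ι K E
    (s * u : (ratDegreeValuation ι K E).valuationSubring))).toNat
  let V : Submodule K E := (restrictTotalDegree ι K m).map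
    (Algebra.linearMap (MvPolynomial ι K) E |>.restrictScalars K)
  refine ⟨(Submodule.pi Set.univ fun _ ↦ V).comap T, ?_, fun a ha hsa ↦ ?_⟩
  · have hV : Module.Finite K V := inferInstance
    have : Module.Finite K (Submodule.pi Set.univ fun _ : Fin (Module.finrank E F) ↦ V) :=
      Module.Finite.iff_fg.2 (Submodule.fg_pi fun _ ↦ Module.Finite.iff_fg.1 hV)
    exact Module.Finite.of_injective (T.restrict (p := (Submodule.pi Set.univ fun _ ↦ V).comap T)
      (q := Submodule.pi Set.univ fun _ ↦ V) fun _ h ↦ h)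
      fun x y h ↦ Subtype.ext (hTinj (congrArg Subtype.val h))
  · rw [Submodule.mem_comap, Submodule.mem_pi]
    intro j _
    have h1 : IsIntegral (MvPolynomial ι K) (T a j) :=
      Algebra.isIntegral_trace (ha.mul (hd _ (Finset.mem_image_of_mem _ (Finset.mem_univ j))))
    obtain ⟨f, hf⟩ := IsIntegrallyClosed.isIntegral_iff.1 h1
    have h2 : IsIntegral (ratDegreeValuation ι K E).valuationSubring
        (((s * u : (ratDegreeValuation ι K E).valuationSubring) : E) * T a j) := by
      have := Algebra.isIntegral_trace (L := E)
        (hsa.mul (hu _ (Finset.mem_image_of_mem _ (Finset.mem_univ j))))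
      rw [smul_mul_smul_comm, ← algebraMap_smul E (s * u), map_smul] at this
      exact this
    obtain ⟨o, ho⟩ := IsIntegrallyClosed.isIntegral_iff.1 h2
    refine ⟨f, ?_, hf⟩
    rw [SetLike.mem_coe, mem_restrictTotalDegree]
    have h3 := o.2
    change algebraMap _ E o ∈ _ at h3
    rw [ho, Valuation.mem_valuationSubring_iff, map_mul, ← hf, ratDegreeValuation_algebraMap] at h3
    rcases eq_or_ne f 0 with rfl | hf0
    · simp
    rw [degreeValuation_apply hf0, ← exp_log hsu, ← exp_add, ← exp_zero, exp_le_exp] at h3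
    omega

theorem Derivation.map_ratDegree_mem_maximalIdeal [Fintype ι] (D : Derivation K F F)
    (hD : ∀ f, D (algebraMap _ F f) = algebraMap _ F (eulerDerivation ι K f))
    (o : (ratDegreeValuation ι K E).valuationSubring) :
    ∃ o' ∈ IsLocalRing.maximalIdeal (ratDegreeValuation ι K E).valuationSubring,
      D (algebraMap _ F o) = algebraMap _ F o' := by
  obtain ⟨f, g, hg, hvfg, ho⟩ := exists_eq_div_of_ratDegree E (F := F) o
  have hlt := degreeValuation_eulerDerivation_mul_sub_lt hg hvfg
  obtain ⟨o', hv, ho'⟩ := exists_ratDegree_eq_div E (F := F) (mul_ne_zero hg hg) hlt.le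
  refine ⟨o', ?_, ?_⟩
  · rwa [Valuation.mem_maximalIdeal_iff, hv,
      div_lt_one₀ (degreeValuation_pos (mul_ne_zero hg hg))]
  · rw [ho', ho, D.leibniz_div, hD, hD]
    simp only [smul_eq_mul, map_mul, map_sub]
    field_simp

variable [IsScalarTower K (MvPolynomial ι K) F]

theorem Derivation.map_algebraMap_mvPolynomial [Fintype ι] (δ : Derivation K F F)
    (f : MvPolynomial ι K) :
    δ (algebraMap _ F f) = ∑ i, algebraMap _ F (pderiv i f) *
      δ (algebraMap (MvPolynomial ι K) F (X i)) := by
  classical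
  induction f using MvPolynomial.induction_on with
  | C a =>
    rw [← MvPolynomial.algebraMap_eq, ← IsScalarTower.algebraMap_apply]
    simp
  | add p q hp hq => simp [hp, hq, add_mul, Finset.sum_add_distrib]
  | mul_X p n hp =>
    have h : ∀ i, algebraMap _ F (pderiv i (p * X n)) * δ (algebraMap (MvPolynomial ι K) F (X i)) =
        (if i = n then algebraMap _ F p * δ (algebraMap (MvPolynomial ι K) F (X i)) else 0) +
          algebraMap (MvPolynomial ι K) F (X n) *
            (algebraMap _ F (pderiv i p) * δ (algebraMap (MvPolynomial ι K) F (X i))) := by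
      intro i
      rw [pderiv_mul, pderiv_X, Pi.single_apply]
      rcases eq_or_ne i n with rfl | hin
      · simp
        ring
      · simp [hin, hin.symm]
        ring
    simp only [h, Finset.sum_add_distrib, Finset.sum_ite_eq', Finset.mem_univ, if_true,
      ← Finset.mul_sum, ← hp]
    rw [map_mul, δ.leibniz, smul_eq_mul, smul_eq_mul]

theorem Derivation.exists_smul_isIntegral_ratDegree [Fintype ι] [FiniteDimensional E F]
    (δ : Derivation K F F) :
    ∃ t : (ratDegreeValuation ι K E).valuationSubring, t ≠ 0 ∧
      ∀ o : (ratDegreeValuation ι K E).valuationSubring,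
        IsIntegral (ratDegreeValuation ι K E).valuationSubring (t • δ (algebraMap _ F o)) := by
  classical
  obtain ⟨t, ht0, ht⟩ := exists_integral_multiples (ratDegreeValuation ι K E).valuationSubring E
    (Finset.univ.image fun i ↦ δ (algebraMap (MvPolynomial ι K) F (X i)))
  refine ⟨t, ht0, fun o ↦ ?_⟩
  obtain ⟨f, g, hg, hvfg, ho⟩ := exists_eq_div_of_ratDegree E (F := F) o
  choose b _ hb using fun i ↦ exists_ratDegree_eq_div E (F := F) (mul_ne_zero hg hg)
    (degreeValuation_pderiv_mul_sub_le hvfg i)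
  have hδ : δ (algebraMap _ F o) = ∑ i, b i • δ (algebraMap (MvPolynomial ι K) F (X i)) := by
    rw [ho, δ.leibniz_div, δ.map_algebraMap_mvPolynomial, δ.map_algebraMap_mvPolynomial]
    simp only [Algebra.smul_def, hb, Algebra.algebraMap_self, RingHom.id_apply, map_mul, map_sub,
      Finset.mul_sum]
    rw [← Finset.sum_sub_distrib, Finset.mul_sum]
    refine Finset.sum_congr rfl fun i _ ↦ ?_
    field_simp
  rw [hδ, Finset.smul_sum]
  refine IsIntegral.sum _ fun i _ ↦ ?_
  rw [smul_comm]
  exact (ht _ (Finset.mem_image_of_mem _ (Finset.mem_univ i))).smul _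

variable (ι K) in
/-- The field of constants lies in the valuation ring of the degree valuation. -/
noncomputable abbrev MvPolynomial.algebraRatDegree :
    Algebra K (ratDegreeValuation ι K E).valuationSubring :=
  (((algebraMap (MvPolynomial ι K) E).comp C).codRestrict
    (ratDegreeValuation ι K E).valuationSubring fun c ↦ by
      rw [Valuation.mem_valuationSubring_iff]
      rcases eq_or_ne c 0 with rfl | hc
      · simp
      · simp [degreeValuation_C hc]).toAlgebra

theorem Derivation.exists_map_algebraMap_mvPolynomial_eq [CharZero K] [FiniteDimensional E F]
    (d : Derivation K (MvPolynomial ι K) (MvPolynomial ι K)) :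
    ∃ D : Derivation K F F, ∀ f, D (algebraMap _ F f) = algebraMap _ F (d f) := by
  have : CharZero E := charZero_of_injective_algebraMap
    (IsFractionRing.injective (MvPolynomial ι K) E)
  have := Algebra.FormallyEtale.of_isLocalization (Rₘ := E) (nonZeroDivisors (MvPolynomial ι K))
  have := Algebra.FormallyEtale.of_isSeparable E F
  have := Algebra.FormallyEtale.comp (MvPolynomial ι K) E F
  exact d.exists_map_algebraMap_eq

theorem Derivation.exists_valuation_ratDegree [CharZero K] [Fintype ι] [FiniteDimensional E F]
    (i : ι) : ∃ (D : Derivation K F F) (w : Valuation F (WithZero (Multiplicative ℤ))),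
      (∀ c : K, c ≠ 0 → w (algebraMap K F c) = 1) ∧
      w (algebraMap (MvPolynomial ι K) F (X i)) ≠ 1 ∧ ∃ e : ℤ, e ≠ 0 ∧
        ∀ x, x ≠ 0 → w (e * (D x / x) - (WithZero.log (w x) : ℤ)) < 1 := by
  have : Nonempty ι := ⟨i⟩
  have : CharZero E := charZero_of_injective_algebraMap
    (IsFractionRing.injective (MvPolynomial ι K) E)
  obtain ⟨D, hD⟩ := (eulerDerivation ι K).exists_map_algebraMap_mvPolynomial_eq E (F := F)
  let := algebraRatDegree ι K E
  have : IsScalarTower K (ratDegreeValuation ι K E).valuationSubring F :=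
    .of_algebraMap_eq fun c ↦ by
      change _ = algebraMap E F (algebraMap _ E (C c))
      rw [← IsScalarTower.algebraMap_apply, ← MvPolynomial.algebraMap_eq,
        ← IsScalarTower.algebraMap_apply]
  have hX0 : algebraMap _ F (X i : MvPolynomial ι K) ≠ 0 := by
    rw [IsScalarTower.algebraMap_apply _ E F]
    simp
  obtain ⟨t, htv, ht⟩ := exists_ratDegree_eq_div E (F := F) (f := 1) (X_ne_zero (R := K) i)
    (by rw [map_one, degreeValuation_X, ← exp_zero, exp_le_exp]; exact zero_le_one)
  rw [map_one, one_div] at ht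
  have ht0 : algebraMap (ratDegreeValuation ι K E).valuationSubring F t ≠ 0 := by
    rw [ht]; exact inv_ne_zero hX0
  obtain ⟨w, hwK, hwt, hw⟩ := Derivation.exists_valuation_logDeriv
    (ratDegreeValuation ι K E).valuationSubring E K (D.restrictScalars ℤ)
    (D.map_ratDegree_mem_maximalIdeal E hD) (t := t)
    (by
      rw [Valuation.mem_maximalIdeal_iff, htv, map_one, degreeValuation_X, one_div,
        ← exp_neg, ← exp_zero, exp_lt_exp]
      exact neg_one_lt_zero)
    (by rintro rfl; simp at ht0)
    (by
      change D _ = _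
      rw [ht, D.leibniz_inv, hD, eulerDerivation_X, smul_eq_mul]
      field_simp)
  refine ⟨D, w, hwK, fun h ↦ ?_, hw⟩
  rw [ht, map_inv₀, h, inv_one] at hwt
  exact lt_irrefl _ hwt

theorem Derivation.exists_finite_logDeriv [CharZero K] [Fintype ι] [Nonempty ι]
    [FiniteDimensional E F] [Algebra K E] [IsScalarTower K (MvPolynomial ι K) E]
    [IsScalarTower K E F] (δ : Derivation K F F) :
    ∃ W : Submodule K F, Module.Finite K W ∧
      ∀ x, x ≠ 0 → IsIntegral (MvPolynomial ι K) (δ x / x) → δ x / x ∈ W := by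
  have : CharZero E := charZero_of_injective_algebraMap
    (IsFractionRing.injective (MvPolynomial ι K) E)
  obtain ⟨s, hs0, hs⟩ := Derivation.exists_smul_logDeriv_isIntegral
    (ratDegreeValuation ι K E).valuationSubring E (δ.restrictScalars ℤ)
    (δ.exists_smul_isIntegral_ratDegree E)
  obtain ⟨W, hW, hWm⟩ := exists_finite_of_isIntegral E (F := F) s hs0
  exact ⟨W, hW, fun x hx hx' ↦ hWm _ hx' (hs x hx)⟩

end RationalFunctions

theorem Derivation.map_eq_zero_of_isAlgebraic {K F : Type*} [Field K] [CharZero K] [Field F]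
    [Algebra K F] (D : Derivation K F F) {x : F} (hx : IsAlgebraic K x) : D x = 0 := by
  have h := D.map_aeval (minpoly K x) x
  rw [minpoly.aeval, map_zero, eq_comm, smul_eq_mul] at h
  exact (mul_eq_zero.mp h).resolve_left
    ((minpoly.irreducible hx.isIntegral).separable.aeval_derivative_ne_zero (minpoly.aeval K x))

theorem MvPolynomial.finiteDimensional_fractionRing {ι K F : Type*} [Field K] [Field F]
    [Algebra K F] [Algebra (MvPolynomial ι K) F] [IsScalarTower K (MvPolynomial ι K) F]
    [Algebra.IsAlgebraic (MvPolynomial ι K) F] [Algebra.EssFiniteType K F]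
    (E : Type*) [Field E] [Algebra K E] [Algebra (MvPolynomial ι K) E]
    [IsFractionRing (MvPolynomial ι K) E] [Algebra E F] [IsScalarTower (MvPolynomial ι K) E F]
    [IsScalarTower K E F] : FiniteDimensional E F := by
  have : Algebra.IsAlgebraic E F :=
    (IsFractionRing.comap_isAlgebraic_iff (A := MvPolynomial ι K)).mp ‹_›
  have : Algebra.EssFiniteType E F := .of_comp K E F
  exact Algebra.finite_of_essFiniteType_of_isAlgebraic

open MvPolynomial in
theorem Derivation.exists_valuation_ne_one {K F : Type*} [Field K] [CharZero K] [Field F]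
    [Algebra K F] [Algebra.EssFiniteType K F] {g : F} (hg : Transcendental K g) :
    ∃ (D : Derivation K F F) (w : Valuation F (WithZero (Multiplicative ℤ))),
      (∀ c : K, c ≠ 0 → w (algebraMap K F c) = 1) ∧ w g ≠ 1 ∧
      ∃ e : ℤ, e ≠ 0 ∧ ∀ x, x ≠ 0 → w (e * (D x / x) - (WithZero.log (w x) : ℤ)) < 1 := by
  obtain ⟨t, hgt, ht⟩ := exists_isTranscendenceBasis_superset (s := {g})
    (algebraicIndependent_unique_type_iff.mpr hg)
  have := finite_of_isTranscendenceBasis ht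
  have := Fintype.ofFinite t
  let := (aeval (R := K) ((↑) : t → F)).toAlgebra
  have : IsScalarTower K (MvPolynomial t K) F :=
    .of_algebraMap_eq fun x ↦ ((aeval (R := K) ((↑) : t → F)).commutes x).symm
  have : FaithfulSMul (MvPolynomial t K) F := (faithfulSMul_iff_algebraMap_injective _ _).mpr ht.1
  have : Algebra.IsAlgebraic (MvPolynomial t K) F :=
    have := ht.isAlgebraic
    .of_ringHom_of_comp_eq ht.1.aevalEquiv.toRingEquiv.toRingHom (RingHom.id F)
      ht.1.aevalEquiv.surjective Function.injective_id <|
        RingHom.ext fun p ↦ ht.1.algebraMap_aevalEquiv p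
  let := FractionRing.liftAlgebra (MvPolynomial t K) F
  have := FractionRing.isScalarTower_liftAlgebra (MvPolynomial t K) F
  have : IsScalarTower K (FractionRing (MvPolynomial t K)) F :=
    .to₁₃₄ K (MvPolynomial t K) (FractionRing (MvPolynomial t K)) F
  have := finiteDimensional_fractionRing (ι := t) (K := K) (F := F)
    (FractionRing (MvPolynomial t K))
  have hX : algebraMap (MvPolynomial t K) F (X ⟨g, hgt rfl⟩) = g := aeval_X _ _
  rw [← hX]
  exact exists_valuation_ratDegree (FractionRing (MvPolynomial t K)) _

open MvPolynomial in
/-- The logarithmic derivatives lying in a finitely generated algebra span a finite-dimensional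
space. -/
theorem Derivation.exists_finite_logDeriv_of_finiteType {K A F : Type*} [Field K] [CharZero K]
    [CommRing A] [IsDomain A] [Algebra K A] [Algebra.FiniteType K A] [Field F] [Algebra A F]
    [IsFractionRing A F] [Algebra K F] [IsScalarTower K A F] (δ : Derivation K F F) :
    ∃ W : Submodule K F, Module.Finite K W ∧
      ∀ x, x ≠ 0 → δ x / x ∈ (algebraMap A F).range → δ x / x ∈ W := by
  obtain ⟨s, φ, hinj, hint⟩ := exists_integral_inj_algHom_of_fg K A
  let := φ.toAlgebra
  let := ((algebraMap A F).comp (algebraMap (MvPolynomial (Fin s) K) A)).toAlgebra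
  have : IsScalarTower (MvPolynomial (Fin s) K) A F := .of_algebraMap_eq fun _ ↦ rfl
  have : IsScalarTower K (MvPolynomial (Fin s) K) A :=
    .of_algebraMap_eq fun x ↦ (φ.commutes x).symm
  have : IsScalarTower K (MvPolynomial (Fin s) K) F := .to₁₂₄ _ _ A _
  have : Algebra.IsIntegral (MvPolynomial (Fin s) K) A := ⟨hint⟩
  have : FaithfulSMul (MvPolynomial (Fin s) K) A :=
    (faithfulSMul_iff_algebraMap_injective _ _).mpr hinj
  have : FaithfulSMul (MvPolynomial (Fin s) K) F := .trans _ A _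
  have : Algebra.IsAlgebraic (MvPolynomial (Fin s) K) F :=
    have := IsLocalization.isAlgebraic (R := A) (S := F) (nonZeroDivisors A)
    .trans _ A _
  have : Algebra.EssFiniteType A F := .of_isLocalization F (nonZeroDivisors A)
  have : Algebra.EssFiniteType K F := .comp K A F
  have key (x : F) (hx : δ x / x ∈ (algebraMap A F).range) :
      IsIntegral (MvPolynomial (Fin s) K) (δ x / x) := by
    obtain ⟨a, ha⟩ := hx
    exact ha ▸ (Algebra.IsIntegral.isIntegral a).algebraMap
  obtain _ | _ := isEmpty_or_nonempty (Fin s)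
  · have : Algebra.IsAlgebraic K F :=
      .of_ringHom_of_comp_eq (isEmptyAlgEquiv K (Fin s)).symm.toRingEquiv.toRingHom
        (RingHom.id F) (isEmptyAlgEquiv K (Fin s)).symm.surjective Function.injective_id <|
        RingHom.ext fun c ↦ by
          simpa using (IsScalarTower.algebraMap_apply K (MvPolynomial (Fin s) K) F c).symm
    refine ⟨⊥, inferInstance, fun x _ _ ↦ ?_⟩
    simp [δ.map_eq_zero_of_isAlgebraic (Algebra.IsAlgebraic.isAlgebraic x)]
  · let := FractionRing.liftAlgebra (MvPolynomial (Fin s) K) F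
    have := FractionRing.isScalarTower_liftAlgebra (MvPolynomial (Fin s) K) F
    have : IsScalarTower K (FractionRing (MvPolynomial (Fin s) K)) F :=
      .to₁₃₄ K (MvPolynomial (Fin s) K) (FractionRing (MvPolynomial (Fin s) K)) F
    have := finiteDimensional_fractionRing (ι := Fin s) (K := K) (F := F)
      (FractionRing (MvPolynomial (Fin s) K))
    obtain ⟨W, hW, h⟩ := exists_finite_logDeriv (ι := Fin s)
      (FractionRing (MvPolynomial (Fin s) K)) δ
    exact ⟨W, hW, fun x hx hxA ↦ h x hx (key x hxA)⟩

/-- Vectors which are horizontal for a connection and linearly independent over the field of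
constants are linearly independent. -/
theorem LinearIndependent.of_horizontal {ι K F V : Type*} [Field K] [Field F] [Algebra K F]
    [AddCommGroup V] [Module F V] [Module K V] [IsScalarTower K F V] (δ : Derivation K F F)
    (hδ : ∀ x, δ x = 0 → x ∈ (algebraMap K F).range) (nabla : V →+ V)
    (hnabla : ∀ (f : F) v, nabla (f • v) = δ f • v + f • nabla v) {v : ι → V}
    (hv : LinearIndependent K v) (hv0 : ∀ i, nabla (v i) = 0) : LinearIndependent F v := by
  classical
  rw [linearIndependent_iff']
  intro s
  induction s using Finset.induction_on with
  | empty => simp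
  | insert a s has ih =>
    intro f hf
    have hfa : f a = 0 := by
      by_contra hfa
      set g : ι → F := fun i ↦ (f a)⁻¹ * f i with hg
      have hg1 : g a = 1 := inv_mul_cancel₀ hfa
      have hgs : ∑ i ∈ insert a s, g i • v i = 0 := by
        simp_rw [hg, mul_smul, ← Finset.smul_sum, hf, smul_zero]
      have hδg : ∀ i ∈ insert a s, δ (g i) = 0 := by
        have h := congrArg nabla hgs
        simp only [map_sum, hnabla, hv0, smul_zero, add_zero, map_zero] at h
        rw [Finset.sum_insert has, hg1, δ.map_one_eq_zero, zero_smul, zero_add] at h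
        simpa [hg1] using ih _ h
      choose! c hc using fun i hi ↦ hδ _ (hδg i hi)
      have hcs : ∑ i ∈ insert a s, c i • v i = 0 := by
        rw [← hgs]
        exact Finset.sum_congr rfl fun i hi ↦ by rw [← hc i hi, algebraMap_smul]
      have hca := linearIndependent_iff'.mp hv _ _ hcs a (Finset.mem_insert_self a s)
      have := hc a (Finset.mem_insert_self a s)
      simp [hca, hg1] at this
    rw [Finset.sum_insert has, hfa, zero_smul, zero_add] at hf
    simpa [hfa] using ih f hf

/-- The functional `D ↦ D x / x` on derivations. -/
def Derivation.logDerivAt (K : Type*) {F : Type*} [Field K] [Field F] [Algebra K F] (x : F) :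
    Derivation K F F →ₗ[F] F where
  toFun D := D x / x
  map_add' D D' := by simp [add_div]
  map_smul' f D := by simp [mul_div_assoc]

theorem Derivation.logDerivAt_bracket {K F : Type*} [Field K] [Field F] [Algebra K F] {x : F}
    (hx : x ≠ 0) (δ D : Derivation K F F) :
    δ (logDerivAt K x D) - logDerivAt K x ⁅δ, D⁆ = D (δ x / x) := by
  simp only [logDerivAt, LinearMap.coe_mk, AddHom.coe_mk, commutator_apply,
    leibniz_div, smul_eq_mul]
  field_simp
  ring

theorem Derivation.exists_linearCombination_logDerivAt_eq_zero {K F : Type*} [Field K] [Field F]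
    [Algebra K F] [Module.Finite F (Derivation K F F)] (δ : Derivation K F F)
    (hδ : ∀ x, δ x = 0 → x ∈ (algebraMap K F).range) {r : ℕ → F} (hr : ∀ j, r j ≠ 0)
    (W : Submodule K F) [Module.Finite K W] (hW : ∀ j, δ (r j) / r j ∈ W) :
    ∃ c : ℕ →₀ K, c ≠ 0 ∧ Finsupp.linearCombination K (fun j ↦ logDerivAt K (r j)) c = 0 := by
  by_contra! H
  let T : (ℕ →₀ K) →ₗ[K] W := Finsupp.linearCombination K fun j ↦ ⟨δ (r j) / r j, hW j⟩
  let L := Finsupp.linearCombination K (fun j ↦ logDerivAt K (r j))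
  have hL : LinearMap.ker L = ⊥ := LinearMap.ker_eq_bot'.mpr fun c hc ↦ by
    by_contra h
    exact H c h hc
  let b := Module.Basis.ofVectorSpace K (LinearMap.ker T)
  have hb : LinearIndependent K fun i ↦ L (b i) :=
    (b.linearIndependent.map' _ (Submodule.ker_subtype _)).map' L hL
  let nabla : (Derivation K F F → F) →+ (Derivation K F F → F) :=
    { toFun η D := δ (η D) - η ⁅δ, D⁆
      map_zero' := by ext; simp
      map_add' η η' := by ext; simp; ring }
  have hb' : LinearIndependent F fun i ↦ L (b i) := by
    refine .of_comp (LinearMap.ltoFun F (Derivation K F F) F F) ?_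
    refine .of_horizontal δ hδ nabla ?_ (hb.map' (LinearMap.ltoFun F (Derivation K F F) F K) ?_) ?_
    · intro f η
      ext D
      simp [nabla]
      ring
    · exact LinearMap.ker_eq_bot.mpr DFunLike.coe_injective
    · intro i
      ext D
      have hi : T (b i) = 0 := (b i).2
      simp only [Function.comp_apply, T, L, nabla, LinearMap.ltoFun_apply,
        AddMonoidHom.coe_mk, ZeroHom.coe_mk, Pi.zero_apply, Finsupp.linearCombination_apply,
        Finsupp.sum, LinearMap.smul_apply, map_sum, Derivation.map_smul,
        ← smul_sub, logDerivAt_bracket (hr _)] at hi ⊢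
      simpa [map_sum] using congrArg (fun x : W ↦ D x) hi
  have := hb'.finite
  have : Module.Finite K (LinearMap.ker T) := .of_basis b
  have : Module.Finite K ((ℕ →₀ K) ⧸ LinearMap.ker T) := .equiv T.quotKerEquivRange.symm
  have : Module.Finite K (ℕ →₀ K) := .of_submodule_quotient (LinearMap.ker T)
  exact not_finite_iff_infinite.mpr inferInstance
    (Finsupp.basisSingleOne (R := K) (ι := ℕ)).linearIndependent.finite

theorem WithZero.exp_sum {ι M : Type*} [AddCommMonoid M] (s : Finset ι) (f : ι → M) :
    exp (∑ i ∈ s, f i) = ∏ i ∈ s, exp (f i) := by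
  classical
  induction s using Finset.induction_on with
  | empty => simp
  | insert i s hi ih => rw [Finset.sum_insert hi, Finset.prod_insert hi, exp_add, ih]

theorem Derivation.exists_prod_zpow_eq_zero {K F : Type*} [Field K] [CharZero K] [Field F]
    [Algebra K F] [Algebra.EssFiniteType K F] (δ : Derivation K F F)
    (hδ : ∀ x, δ x = 0 → x ∈ (algebraMap K F).range) {r : ℕ → F} (hr : ∀ j, r j ≠ 0)
    (W : Submodule K F) [Module.Finite K W] (hW : ∀ j, δ (r j) / r j ∈ W) :
    ∃ n : ℕ →₀ ℤ, n ≠ 0 ∧ δ (∏ j ∈ n.support, r j ^ n j) = 0 := by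
  have : Module.Finite F (Derivation K F F) :=
    .equiv (KaehlerDifferential.linearMapEquivDerivation K F)
  obtain ⟨c, hc0, hc⟩ := exists_linearCombination_logDerivAt_eq_zero δ hδ hr W hW
  obtain ⟨j₀, hj₀⟩ := Finsupp.ne_iff.mp hc0
  obtain ⟨φ, hφ⟩ := Module.Projective.exists_dual_ne_zero ℚ hj₀
  obtain ⟨b, hb⟩ := IsLocalization.exist_integer_multiples (nonZeroDivisors ℤ) c.support
    fun j ↦ φ (c j)
  have hb' (j : ℕ) : ∃ m : ℤ, (m : ℚ) = (b : ℤ) * φ (c j) := by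
    by_cases hj : j ∈ c.support
    · obtain ⟨m, hm⟩ := hb j hj
      exact ⟨m, by simpa using hm⟩
    · exact ⟨0, by simp [Finsupp.notMem_support_iff.mp hj]⟩
  choose m hm using hb'
  have hmc (j : ℕ) (hj : m j ≠ 0) : j ∈ c.support := by
    contrapose! hj
    simpa [Finsupp.notMem_support_iff.mp hj] using hm j
  have hb0 : ((b : ℤ) : ℚ) ≠ 0 := by exact_mod_cast nonZeroDivisors.coe_ne_zero b
  let n : ℕ →₀ ℤ := .onFinset c.support m hmc
  refine ⟨n, Finsupp.ne_iff.mpr ⟨j₀, ?_⟩, ?_⟩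
  · have : (m j₀ : ℚ) ≠ 0 := hm j₀ ▸ mul_ne_zero hb0 hφ
    exact_mod_cast this
  by_contra hg
  have htr : Transcendental K (∏ j ∈ n.support, r j ^ n j) :=
    fun h ↦ hg (δ.map_eq_zero_of_isAlgebraic h)
  obtain ⟨D, w, hwK, hwg, e, -, hw⟩ := exists_valuation_ne_one htr
  have hw0 (j : ℕ) : w (r j) ≠ 0 := w.ne_zero_iff.mpr (hr j)
  set l : ℕ → ℤ := fun j ↦ WithZero.log (w (r j))
  have hsum : ∑ j ∈ c.support, c j * (l j : K) = 0 := by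
    by_contra h
    have hlt : w (∑ j ∈ c.support, c j • (e * (D (r j) / r j) - (l j : F))) < 1 := by
      refine w.map_sum_lt one_ne_zero fun j hj ↦ ?_
      rw [Algebra.smul_def, map_mul, hwK _ (Finsupp.mem_support_iff.mp hj), one_mul]
      exact hw _ (hr j)
    have hD : ∑ j ∈ c.support, c j • (D (r j) / r j) = 0 := by
      simpa [Finsupp.linearCombination_apply, Finsupp.sum, logDerivAt] using
        congrArg (fun f : Derivation K F F →ₗ[F] F ↦ f D) hc
    have heq : ∑ j ∈ c.support, c j • (e * (D (r j) / r j) - (l j : F)) =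
        -algebraMap K F (∑ j ∈ c.support, c j * (l j : K)) := by
      simp_rw [smul_sub, ← Algebra.mul_smul_comm]
      rw [Finset.sum_sub_distrib, ← Finset.mul_sum, hD, mul_zero, zero_sub, map_sum]
      simp [Algebra.smul_def]
    rw [heq, Valuation.map_neg, hwK _ h] at hlt
    exact hlt.false
  have hsum' : ∑ j ∈ c.support, m j * l j = 0 := by
    have h := congrArg (fun x ↦ (b : ℚ) * φ x) hsum
    have hφ' (j : ℕ) : φ (c j * (l j : K)) = l j * φ (c j) := by
      rw [mul_comm, ← zsmul_eq_mul, map_zsmul, zsmul_eq_mul]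
    simp only [map_sum, hφ', Finset.mul_sum, map_zero, mul_zero] at h
    have : ((∑ j ∈ c.support, m j * l j : ℤ) : ℚ) = 0 := by
      push_cast
      rw [← h]
      exact Finset.sum_congr rfl fun j _ ↦ by rw [hm]; ring
    exact_mod_cast this
  apply hwg
  have hexp (j : ℕ) : w (r j) = WithZero.exp (l j) := (WithZero.exp_log (hw0 j)).symm
  simp_rw [map_prod, map_zpow₀, hexp, ← WithZero.exp_zsmul,
    ← WithZero.exp_sum, WithZero.exp_eq_one]
  rw [← hsum']
  exact Finset.sum_subset Finsupp.support_onFinset_subset fun j _ hj ↦ by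
    simp [Finsupp.notMem_support_iff.mp hj]

/-- The field of constants of a derivation. -/
def Derivation.constants {k F : Type*} [Field k] [Field F] [Algebra k F] (δ : Derivation k F F) :
    IntermediateField k F where
  carrier := {x | δ x = 0}
  mul_mem' {x y} hx hy := by simp_all
  add_mem' {x y} hx hy := by simp_all
  algebraMap_mem' c := δ.map_algebraMap c
  inv_mem' x hx := by simp_all [leibniz_inv]

theorem Derivation.mem_constants {k F : Type*} [Field k] [Field F] [Algebra k F]
    {δ : Derivation k F F} {x : F} : x ∈ δ.constants ↔ δ x = 0 := Iff.rfl

/-- A derivation, regarded as linear over its field of constants. -/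
def Derivation.overConstants {k F : Type*} [Field k] [Field F] [Algebra k F]
    (δ : Derivation k F F) : Derivation δ.constants F F :=
  .mk' { toFun := δ
         map_add' := δ.map_add
         map_smul' c x := by simp [Algebra.smul_def, mem_constants.mp c.2] }
    δ.leibniz

theorem Derivation.exists_finite_constants_logDeriv {k A F : Type*} [Field k] [CharZero k]
    [CommRing A] [IsDomain A] [Algebra k A] [Algebra.FiniteType k A] [Field F] [Algebra A F]
    [IsFractionRing A F] [Algebra k F] [IsScalarTower k A F] (δ : Derivation k F F) :
    ∃ W : Submodule δ.constants F, Module.Finite δ.constants W ∧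
      ∀ x, x ≠ 0 → δ x / x ∈ (algebraMap A F).range → δ x / x ∈ W := by
  classical
  obtain ⟨s, hs⟩ := Algebra.FiniteType.out (R := k) (A := A)
  let B := Algebra.adjoin δ.constants (algebraMap A F '' s)
  have hB (a : A) : algebraMap A F a ∈ B := by
    have : (Algebra.adjoin k (s : Set A)).map (IsScalarTower.toAlgHom k A F) ≤
        B.restrictScalars k := by
      rw [AlgHom.map_adjoin, Algebra.adjoin_le_iff]
      exact Algebra.subset_adjoin
    exact this ⟨a, hs ▸ Algebra.mem_top, rfl⟩
  have : Algebra.FiniteType δ.constants B := B.fg_iff_finiteType.mp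
    ⟨s.image (algebraMap A F), by simp [B]⟩
  have : IsFractionRing B F := .of_field _ _ fun z ↦ by
    obtain ⟨a, b, -, rfl⟩ := IsFractionRing.div_surjective (A := A) z
    exact ⟨⟨_, hB a⟩, ⟨_, hB b⟩, rfl⟩
  obtain ⟨W, hW, h⟩ := exists_finite_logDeriv_of_finiteType (A := B) δ.overConstants
  refine ⟨W, hW, fun x hx hxA ↦ h x hx ?_⟩
  obtain ⟨a, ha⟩ := hxA
  exact ⟨⟨_, hB a⟩, ha⟩

/-- **Proposition 2.5.** -/
theorem log_derivatives_give_constant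
    (k : Type*) [Field k] [CharZero k]
    -- `k` is a finitely generated field
    (hk : (⊤ : IntermediateField ℚ k).FG)
    (A : Type*) [CommRing A] [IsDomain A] [Algebra k A] [Algebra.FiniteType k A]
    (δ : Derivation k A A)
    -- `FA` is the fraction field of `A`, and `δ'` the (unique) extension of `δ` to it
    (FA : Type*) [Field FA] [Algebra A FA] [IsFractionRing A FA]
    [Algebra k FA] [IsScalarTower k A FA]
    (δ' : Derivation k FA FA)
    (hcompat : ∀ x : A, δ' (algebraMap A FA x) = algebraMap A FA (δ x))
    (r : ℕ → FA) (hr0 : ∀ j, r j ≠ 0)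
    -- `δ(r_j)/r_j ∈ A` for all `j`
    (hlog : ∀ j, ∃ a : A, δ' (r j) = r j * algebraMap A FA a)
    -- `(r_j)` is multiplicatively independent modulo `(k^alg)ˣ`
    (hmi : ∀ n : ℕ →₀ ℤ, IsAlgebraic k (∏ j ∈ n.support, r j ^ n j) → n = 0) :
    (∃ g : FA, δ' g = 0 ∧ ¬ IsAlgebraic k g) ∧
    -- in fact, the multiplicative group generated by the `r_j` contains a constant `≠ 1`
    (∃ g : FA, g ≠ 1 ∧ (∃ n : ℕ →₀ ℤ, g = ∏ j ∈ n.support, r j ^ n j) ∧ δ' g = 0) := by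
  obtain ⟨W, _, hW⟩ := δ'.exists_finite_constants_logDeriv (A := A)
  have : Algebra.EssFiniteType A FA := .of_isLocalization FA (nonZeroDivisors A)
  have : Algebra.EssFiniteType k FA := .comp k A FA
  have : Algebra.EssFiniteType δ'.constants FA := .of_comp k δ'.constants FA
  obtain ⟨n, hn0, hn⟩ := δ'.overConstants.exists_prod_zpow_eq_zero (fun x hx ↦ ⟨⟨x, hx⟩, rfl⟩)
    hr0 W fun j ↦ hW _ (hr0 j) <| by
      obtain ⟨a, ha⟩ := hlog j
      exact ⟨a, by rw [ha, mul_div_cancel_left₀ _ (hr0 j)]⟩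
  have hg : ¬ IsAlgebraic k (∏ j ∈ n.support, r j ^ n j) := fun h ↦ hn0 (hmi n h)
  refine ⟨⟨_, hn, hg⟩, _, ?_, ⟨n, rfl⟩, hn⟩
  rintro h
  exact hg (h ▸ isAlgebraic_one)
end

section
/- Let A ⊆ B be an étale extension of noetherian unique factorisation domains, and let I be a height one radical ideal of A. Then the extension ideal IB is radical. Moreover, if A and B are in addition finitely generated k-algebras over a field k, φ : Spec(B) → Spec(A) is the induced morphism, and H := V(I) is the corresponding hypersurface on Spec(A), then the scheme-theoretic inverse image φ⁻¹(H) equals the proper transform φ*H. -/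
/-!
# Lemma 6.4: radicality and proper transforms along étale extensions

`A ⊆ B` is an étale extension of noetherian unique factorisation domains and `I` is a
height one radical ideal of `A` (the vanishing ideal of a hypersurface: all its minimal
primes have height one).  Then `I·B` is radical.  Moreover, if `A` and `B` are finitely
generated algebras over a field `k`, then the scheme-theoretic inverse image of the
hypersurface `H = V(I)` along `Spec B → Spec A` equals its proper transform.
-/

/-- A prime ideal `P` of a commutative ring has height one. -/
def HeightOnePrime {R : Type*} [CommRing R] (P : Ideal R) : Prop :=
  P.IsPrime ∧ P ≠ ⊥ ∧ ∀ Q : Ideal R, Q.IsPrime → Q < P → Q = ⊥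

/-- The vanishing ideal of the proper transform of `V(I)` along the dominant map induced
by `f`. -/
def properTransform {R S : Type*} [CommRing R] [CommRing S] (f : R →+* S) (I : Ideal R) :
    Ideal S :=
  sInf {Q : Ideal S | Q ∈ (I.map f).minimalPrimes ∧ Q.comap f ∈ I.minimalPrimes}

open scoped TensorProduct in
/-- Radical ideals of a Noetherian ring extend to radical ideals along étale algebras. -/
theorem Ideal.IsRadical.map_of_etale {A B : Type*} [CommRing A] [IsNoetherianRing A]
    [CommRing B] [Algebra A B] [Algebra.Etale A B] {I : Ideal A} (hI : I.IsRadical) :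
    (I.map (algebraMap A B)).IsRadical := by
  classical
  have : Fintype I.minimalPrimes := (I.finite_minimalPrimes_of_isNoetherianRing A).fintype
  have (P : I.minimalPrimes) : P.1.IsPrime := P.2.1.1
  let F : A →ₐ[A] Π P : I.minimalPrimes, P.1.ResidueField := Algebra.ofId A _
  have hF : RingHom.ker F = I := by
    ext x
    have hx : x ∈ I ↔ x ∈ sInf I.minimalPrimes := by rw [Ideal.sInf_minimalPrimes, hI.radical]
    rw [RingHom.mem_ker, funext_iff, hx, Ideal.mem_sInf]
    simp [F, Algebra.ofId_apply, Pi.algebraMap_apply]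
  let G : (A ⧸ I) →ₐ[A] Π P : I.minimalPrimes, P.1.ResidueField :=
    Ideal.Quotient.liftₐ I F fun x hx ↦ by rwa [← hF] at hx
  have hG : Function.Injective G :=
    RingHom.lift_injective_of_ker_le_ideal I _ hF.le
  have (P : I.minimalPrimes) : IsReduced (B ⊗[A] P.1.ResidueField) := by
    have : IsReduced (P.1.ResidueField ⊗[A] B) :=
      Algebra.FormallyUnramified.isReduced_of_field P.1.ResidueField _
    exact isReduced_of_injective (Algebra.TensorProduct.comm A B P.1.ResidueField)
      (AlgEquiv.injective _)
  have : IsReduced (B ⊗[A] Π P : I.minimalPrimes, P.1.ResidueField) :=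
    isReduced_of_injective (Algebra.TensorProduct.piRight A B B
      fun P : I.minimalPrimes ↦ P.1.ResidueField) (AlgEquiv.injective _)
  have : IsReduced (B ⊗[A] (A ⧸ I)) :=
    isReduced_of_injective (Algebra.TensorProduct.map (AlgHom.id A B) G)
      (Module.Flat.lTensor_preserves_injective_linearMap (M := B) G.toLinearMap hG)
  rw [Ideal.isRadical_iff_quotient_reduced]
  exact isReduced_of_injective (Algebra.TensorProduct.quotIdealMapEquivTensorQuot B I)
    (AlgEquiv.injective _)

/-- Along a ring extension with going down, minimal primes of an extended ideal lie over minimal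
primes of the ideal. -/
theorem Ideal.comap_mem_minimalPrimes_of_hasGoingDown {A B : Type*} [CommRing A] [CommRing B]
    [Algebra A B] [Algebra.HasGoingDown A B] {I : Ideal A} {Q : Ideal B}
    (hQ : Q ∈ (I.map (algebraMap A B)).minimalPrimes) :
    Q.comap (algebraMap A B) ∈ I.minimalPrimes := by
  have := hQ.1.1
  refine ⟨⟨inferInstance, Ideal.map_le_iff_le_comap.mp hQ.1.2⟩, fun p ⟨_, hIp⟩ hle ↦ ?_⟩
  obtain ⟨P, hPQ, hP, hPp⟩ :=
    Ideal.exists_ideal_le_liesOver_of_le (p := p) (q := Q.under A) Q hle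
  rw [hPp.over] at hIp ⊢
  exact Ideal.comap_mono (hQ.2 ⟨hP, Ideal.map_le_iff_le_comap.mpr hIp⟩ hPQ)

/-- **Lemma 6.4.** -/
theorem radical_etale
    (A B : Type u) [CommRing A] [IsDomain A] [IsNoetherianRing A]
    [UniqueFactorizationMonoid A]
    [CommRing B] [IsDomain B] [IsNoetherianRing B] [UniqueFactorizationMonoid B]
    [Algebra A B] (hinj : Function.Injective (algebraMap A B))
    [Algebra.Etale A B]
    (I : Ideal A) (hrad : I.IsRadical) (htop : I ≠ ⊤)
    (hht : ∀ P ∈ I.minimalPrimes, HeightOnePrime P) :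
    (I.map (algebraMap A B)).IsRadical
    ∧
    (∀ (k : Type*) [Field k] [Algebra k A] [Algebra k B],
      ∀ _ : IsScalarTower k A B, Algebra.FiniteType k A → Algebra.FiniteType k B →
      I.map (algebraMap A B) = properTransform (algebraMap A B) I) := by
  have hJ : (I.map (algebraMap A B)).IsRadical := hrad.map_of_etale
  refine ⟨hJ, fun k _ _ _ _ _ _ ↦ ?_⟩
  refine (hJ.radical.symm.trans Ideal.sInf_minimalPrimes.symm).trans (congrArg sInf ?_)
  ext Q
  exact ⟨fun hQ ↦ ⟨hQ, Ideal.comap_mem_minimalPrimes_of_hasGoingDown hQ⟩, And.left⟩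
end
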